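/- arXiv:1606.04417 — 2 statements merged into one kernel-verified Lean document; each statement's English description precedes it below -/
import Mathlib

section
/- Let X be a real M1×N matrix and Y a real M2×N matrix such that X·Xᵀ and Y·Yᵀ are invertible. Define the orthogonal projections P_x = Xᵀ(X Xᵀ)⁻¹X and P_y = Yᵀ(Y Yᵀ)⁻¹Y, and let S = (X Xᵀ)⁻¹ X Yᵀ (Y Yᵀ)⁻¹ Y Xᵀ. Then a nonzero scalar μ is an eigenvalue of the M1×M1 matrix S if and only if μ is an eigenvalue of the N×N matrix P_y P_x P_y. -/
open Matrix

/-- `μ` is an eigenvalue of the matrix `M`. -/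
def hasEigen {n : Type*} [Fintype n] (M : Matrix n n ℂ) (μ : ℂ) : Prop :=
  ∃ v : n → ℂ, v ≠ 0 ∧ M.mulVec v = μ • v

theorem hasEigen_mul_swap {m n : Type*} [Fintype m] [Fintype n]
    (A : Matrix m n ℂ) (B : Matrix n m ℂ) {μ : ℂ} (hμ : μ ≠ 0)
    (h : hasEigen (A * B) μ) : hasEigen (B * A) μ := by
  obtain ⟨v, hv, hAB⟩ := h
  rw [← mulVec_mulVec] at hAB
  refine ⟨B *ᵥ v, fun h0 => ?_, ?_⟩
  · rw [h0, mulVec_zero] at hAB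
    exact smul_ne_zero hμ hv hAB.symm
  · rw [← mulVec_mulVec, hAB, mulVec_smul]

theorem hasEigen_mul_comm {m n : Type*} [Fintype m] [Fintype n]
    (A : Matrix m n ℂ) (B : Matrix n m ℂ) {μ : ℂ} (hμ : μ ≠ 0) :
    hasEigen (A * B) μ ↔ hasEigen (B * A) μ :=
  ⟨hasEigen_mul_swap A B hμ, hasEigen_mul_swap B A hμ⟩

/-- a nonzero scalar `μ` is an eigenvalue of the CCA matrix
`S = (X Xᵀ)⁻¹ X Yᵀ (Y Yᵀ)⁻¹ Y Xᵀ` iff it is an eigenvalue of `P_y P_x P_y`. -/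
theorem stmt_0 {M1 M2 N : ℕ}
    (X : Matrix (Fin M1) (Fin N) ℝ) (Y : Matrix (Fin M2) (Fin N) ℝ)
    (hX : IsUnit (X * Xᵀ).det) (hY : IsUnit (Y * Yᵀ).det)
    (Px : Matrix (Fin N) (Fin N) ℝ) (hPx : Px = Xᵀ * (X * Xᵀ)⁻¹ * X)
    (Py : Matrix (Fin N) (Fin N) ℝ) (hPy : Py = Yᵀ * (Y * Yᵀ)⁻¹ * Y)
    (S : Matrix (Fin M1) (Fin M1) ℝ)
    (hS : S = (X * Xᵀ)⁻¹ * (X * Yᵀ) * (Y * Yᵀ)⁻¹ * (Y * Xᵀ))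
    (μ : ℂ) (hμ : μ ≠ 0) :
    hasEigen (S.map Complex.ofReal) μ ↔
      hasEigen ((Py * Px * Py).map Complex.ofReal) μ := by
  have hPy_idem : Py * Py = Py := by
    calc Py * Py = Yᵀ * ((Y * Yᵀ)⁻¹ * (Y * Yᵀ)) * (Y * Yᵀ)⁻¹ * Y := by
          simp only [hPy, Matrix.mul_assoc]
      _ = Py := by rw [nonsing_inv_mul _ hY, Matrix.mul_one, hPy]
  have hS_factor : S = ((X * Xᵀ)⁻¹ * X * Py) * (Py * Xᵀ) := by
    calc S = (X * Xᵀ)⁻¹ * X * Py * Xᵀ := by simp only [hS, hPy, Matrix.mul_assoc]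
      _ = (X * Xᵀ)⁻¹ * X * (Py * Py) * Xᵀ := by rw [hPy_idem]
      _ = ((X * Xᵀ)⁻¹ * X * Py) * (Py * Xᵀ) := by simp only [Matrix.mul_assoc]
  have hP_factor : Py * Px * Py = (Py * Xᵀ) * ((X * Xᵀ)⁻¹ * X * Py) := by
    simp only [hPx, Matrix.mul_assoc]
  have map_mul_ofReal {k l m : ℕ} (A : Matrix (Fin k) (Fin l) ℝ) (B : Matrix (Fin l) (Fin m) ℝ) :
      (A * B).map Complex.ofReal = A.map Complex.ofReal * B.map Complex.ofReal :=
    Matrix.map_mul (f := Complex.ofRealHom)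
  rw [hS_factor, hP_factor, map_mul_ofReal, map_mul_ofReal (Py * Xᵀ)]
  exact hasEigen_mul_comm _ _ hμ
end

section
/- Consider the multivariate linear model Y = X B + Z, where X is a real N×p1 matrix with XᵀX invertible, B is p1×p2, Z is N×p2, and let C1 be a real g1×p1 matrix such that C1(XᵀX)⁻¹C1ᵀ is invertible. Define B̂ = (XᵀX)⁻¹XᵀY, X̃ = X(XᵀX)⁻¹C1ᵀ, P_{X̃} = X̃(X̃ᵀX̃)⁻¹X̃ᵀ, and P_X = X(XᵀX)⁻¹Xᵀ. If C1 B = γ1 (the null hypothesis), then the hypothesis SSCP satisfies H1 = (C1 B̂ − γ1)ᵀ[C1(XᵀX)⁻¹C1ᵀ]⁻¹(C1 B̂ − γ1) = Zᵀ P_{X̃} Z, and (without assuming the null hypothesis) the error SSCP satisfies E1 = Yᵀ(I_N − P_X)Y = Zᵀ(I_N − P_X)Z. -/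
open Matrix

/-- in the multivariate linear model `Y = XB + Z`, under the null
hypothesis `C1 B = γ1` the hypothesis SSCP equals `Zᵀ P_{X̃} Z`, and (without the
null hypothesis) the error SSCP equals `Zᵀ(I − P_X)Z`. -/
theorem stmt_10 {N p1 p2 g1 : ℕ}
    (X : Matrix (Fin N) (Fin p1) ℝ) (B : Matrix (Fin p1) (Fin p2) ℝ)
    (Z : Matrix (Fin N) (Fin p2) ℝ)
    (C1 : Matrix (Fin g1) (Fin p1) ℝ) (γ1 : Matrix (Fin g1) (Fin p2) ℝ)
    (hXX : IsUnit (Xᵀ * X).det)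
    (hC : IsUnit (C1 * (Xᵀ * X)⁻¹ * C1ᵀ).det)
    (Y : Matrix (Fin N) (Fin p2) ℝ) (hY : Y = X * B + Z)
    (Bhat : Matrix (Fin p1) (Fin p2) ℝ) (hBhat : Bhat = (Xᵀ * X)⁻¹ * Xᵀ * Y)
    (Xt : Matrix (Fin N) (Fin g1) ℝ) (hXt : Xt = X * (Xᵀ * X)⁻¹ * C1ᵀ)
    (PXt : Matrix (Fin N) (Fin N) ℝ) (hPXt : PXt = Xt * (Xtᵀ * Xt)⁻¹ * Xtᵀ)
    (PX : Matrix (Fin N) (Fin N) ℝ) (hPX : PX = X * (Xᵀ * X)⁻¹ * Xᵀ) :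
    (C1 * B = γ1 →
      (C1 * Bhat - γ1)ᵀ * (C1 * (Xᵀ * X)⁻¹ * C1ᵀ)⁻¹ * (C1 * Bhat - γ1)
        = Zᵀ * PXt * Z) ∧
    Yᵀ * (1 - PX) * Y = Zᵀ * (1 - PX) * Z := by
  have hT : (Xᵀ * X)⁻¹ᵀ = (Xᵀ * X)⁻¹ := by
    rw [transpose_nonsing_inv, transpose_mul, transpose_transpose]
  have hXtT : Xtᵀ = C1 * (Xᵀ * X)⁻¹ * Xᵀ := by
    rw [hXt, transpose_mul, transpose_mul, transpose_transpose, hT, Matrix.mul_assoc]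
  have hinv : (Xᵀ * X)⁻¹ * Xᵀ * X = 1 := by
    rw [Matrix.mul_assoc, nonsing_inv_mul _ hXX]
  constructor
  · intro hB
    have hgram : Xtᵀ * Xt = C1 * (Xᵀ * X)⁻¹ * C1ᵀ := by
      calc Xtᵀ * Xt = C1 * ((Xᵀ * X)⁻¹ * Xᵀ * X) * (Xᵀ * X)⁻¹ * C1ᵀ := by
            rw [hXtT, hXt]; simp only [Matrix.mul_assoc]
        _ = _ := by rw [hinv, Matrix.mul_one]
    have hdev : C1 * Bhat - γ1 = Xtᵀ * Z := by
      rw [hBhat, hY, Matrix.mul_add, ← Matrix.mul_assoc _ X B, hinv, Matrix.one_mul,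
        Matrix.mul_add, hB, add_sub_cancel_left, hXtT]
      simp only [Matrix.mul_assoc]
    rw [hdev, hPXt, hgram, transpose_mul, transpose_transpose]
    simp only [Matrix.mul_assoc]
  · have hright : (1 - PX) * X = 0 := by
      rw [Matrix.sub_mul, Matrix.one_mul, hPX, Matrix.mul_assoc, Matrix.mul_assoc,
        nonsing_inv_mul _ hXX, Matrix.mul_one, sub_self]
    have hleft : Xᵀ * (1 - PX) = 0 := by
      rw [Matrix.mul_sub, Matrix.mul_one, hPX, ← Matrix.mul_assoc, ← Matrix.mul_assoc,
        mul_nonsing_inv _ hXX, Matrix.one_mul, sub_self]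
    rw [hY, Matrix.mul_assoc, Matrix.mul_add, ← Matrix.mul_assoc _ X B, hright,
      Matrix.zero_mul, zero_add, ← Matrix.mul_assoc, transpose_add, transpose_mul,
      Matrix.add_mul, Matrix.mul_assoc, hleft, Matrix.mul_zero, zero_add]
end
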